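/- arXiv:2308.10221 — 2 statements merged into one kernel-verified Lean document; each statement's English description precedes it below -/
import Mathlib

section
/- There is exactly one continuously differentiable function z on ℝ satisfying z'(s) + (n-2-2mα/β)·z(s) + m·z(s)² + β·e^{-(ρ1/β)s}·w̃(s)^{1-m}·z(s) = (α/β)(n-2-mα/β) for all s ∈ ℝ, where w̃(s) = η·exp(∫_{-∞}^{s} z(ρ) dρ), and such that 0 < z(s)·e^{-(ρ1/β)s} ≤ C4·η^{m-1} for all s ∈ ℝ. -/
open Real Set Filter MeasureTheory

/-- `z` is a solution on `ℝ` of the ODE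
`z' + (n-2-2mα/β) z + m z² + β e^{-(ρ1/β)s} w̃^{1-m} z = (α/β)(n-2-mα/β)` where
`w̃(s) = η exp(∫_{-∞}^s z)`, satisfying `0 < z(s) e^{-(ρ1/β)s} ≤ C4 η^{m-1}`. -/
def ZODEReal (n : ℕ) (m ρ1 η β α C4 : ℝ) (z : ℝ → ℝ) : Prop :=
  ContDiff ℝ 1 z ∧
  (∀ s : ℝ, MeasureTheory.IntegrableOn z (Set.Iio s)) ∧
  (∀ s : ℝ,
    deriv z s + ((n : ℝ) - 2 - 2 * m * α / β) * z s + m * z s ^ 2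
      + β * Real.exp (-(ρ1 / β) * s) *
          (η * Real.exp (∫ ρ in Set.Iio s, z ρ)) ^ (1 - m) * z s
      = α / β * ((n : ℝ) - 2 - m * α / β)) ∧
  (∀ s : ℝ, 0 < z s * Real.exp (-(ρ1 / β) * s) ∧
    z s * Real.exp (-(ρ1 / β) * s) ≤ C4 * η ^ (m - 1))

open scoped Topology BoundedContinuousFunction

section Auxiliary

/-- A continuous function dominated by the derivative of a nonnegative function is integrable
on left half-lines, with the expected bound. -/
theorem integrableOn_Iic_and_abs_integral_le {f Y Y' : ℝ → ℝ} (hf : Continuous f)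
    (hY : ∀ t, HasDerivAt Y (Y' t) t) (hY0 : ∀ t, 0 ≤ Y t) (h : ∀ t, |f t| ≤ Y' t) (s : ℝ) :
    IntegrableOn f (Iic s) ∧ |∫ t in Iio s, f t| ≤ Y s := by
  have key : ∀ᶠ r in atBot, ∫ t in r..s, ‖f t‖ ≤ Y s := by
    filter_upwards [eventually_le_atBot s] with r hr
    have := intervalIntegral.integral_le_sub_of_hasDeriv_right_of_le hr
      (fun t _ => (hY t).continuousAt.continuousWithinAt)
      (fun t _ => (hY t).hasDerivWithinAt) (hf.norm.integrableOn_Icc)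
      (fun t _ => h t)
    linarith [hY0 r]
  have hint : IntegrableOn f (Iic s) :=
    integrableOn_Iic_of_intervalIntegral_norm_bounded (Y s) s
      (fun r => (hf.integrableOn_Icc (a := r)).mono_set Ioc_subset_Icc_self) tendsto_id key
  refine ⟨hint, ?_⟩
  rw [← integral_Iic_eq_integral_Iio]
  exact (norm_integral_le_integral_norm f).trans
    (le_of_tendsto (intervalIntegral_tendsto_integral_Iic s hint.norm tendsto_id) key)

theorem hasDerivAt_integral_Iio {f : ℝ → ℝ} (hf : Continuous f)
    (hint : ∀ s, IntegrableOn f (Iic s)) (s : ℝ) :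
    HasDerivAt (fun s => ∫ t in Iio s, f t) (f s) s := by
  have hEq : (fun s => ∫ t in Iio s, f t) =
      fun s => (∫ t in (0 : ℝ)..s, f t) + ∫ t in Iic 0, f t := by
    funext r
    rw [← intervalIntegral.integral_Iic_sub_Iic (hint 0) (hint r), integral_Iic_eq_integral_Iio]
    ring
  rw [hEq]
  exact (intervalIntegral.integral_hasDerivAt_right (hf.intervalIntegrable _ _)
    (hf.stronglyMeasurableAtFilter _ _) hf.continuousAt).add_const _

/-- Banach's fixed point theorem for a weighted supremum distance on an order interval of
continuous functions. -/
theorem exists_continuous_fixedPoint_of_weighted_contraction {φ κ : ℝ → ℝ} {M : ℝ}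
    (hφ : Continuous φ) (hφ0 : ∀ s, 0 < φ s) (hκ0 : ∀ s, 0 ≤ κ s) (hκ : ∀ s, κ s ≤ M * φ s)
    (T : (ℝ → ℝ) → ℝ → ℝ)
    (hT : ∀ z, Continuous z → (∀ s, 0 ≤ z s ∧ z s ≤ κ s) →
      Continuous (T z) ∧ ∀ s, 0 ≤ T z s ∧ T z s ≤ κ s)
    (hC : ∀ z₁ z₂, Continuous z₁ → (∀ s, 0 ≤ z₁ s ∧ z₁ s ≤ κ s) →
      Continuous z₂ → (∀ s, 0 ≤ z₂ s ∧ z₂ s ≤ κ s) → ∀ C, 0 ≤ C →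
      (∀ s, |z₁ s - z₂ s| ≤ C * φ s) → ∀ s, |T z₁ s - T z₂ s| ≤ C / 2 * φ s) :
    ∃ z, Continuous z ∧ (∀ s, 0 ≤ z s ∧ z s ≤ κ s) ∧ T z = z := by
  let K : Set (ℝ →ᵇ ℝ) := {v | ∀ s, 0 ≤ φ s * v s ∧ φ s * v s ≤ κ s}
  have hK : IsClosed K := by
    have : K = ⋂ s, {v : ℝ →ᵇ ℝ | 0 ≤ φ s * v s} ∩ {v : ℝ →ᵇ ℝ | φ s * v s ≤ κ s} := by
      ext v
      simp [K]
    rw [this]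
    refine isClosed_iInter fun s => IsClosed.inter ?_ ?_
    · exact isClosed_le continuous_const
        (continuous_const.mul (continuous_eval_const s))
    · exact isClosed_le
        (continuous_const.mul (continuous_eval_const s))
        continuous_const
  have : CompleteSpace K := hK.completeSpace_coe
  have hcont (v : K) : Continuous fun s => φ s * v.1 s := hφ.mul v.1.continuous
  have hTv (v : K) := hT _ (hcont v) v.2
  let F : K → K := fun v =>
    ⟨BoundedContinuousFunction.ofNormedAddCommGroup (fun s => T (fun s => φ s * v.1 s) s / φ s)
      ((hTv v).1.div hφ fun s => (hφ0 s).ne') M (fun s => by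
        rw [Real.norm_eq_abs, abs_of_nonneg (div_nonneg ((hTv v).2 s).1 (hφ0 s).le),
          div_le_iff₀ (hφ0 s)]
        exact ((hTv v).2 s).2.trans (hκ s)), fun s => by
        simp only [BoundedContinuousFunction.coe_ofNormedAddCommGroup]
        rw [mul_div_cancel₀ _ (hφ0 s).ne']
        exact (hTv v).2 s⟩
  have hF (v : K) (s : ℝ) : φ s * (F v).1 s = T (fun s => φ s * v.1 s) s := by
    simp only [F, BoundedContinuousFunction.coe_ofNormedAddCommGroup]
    rw [mul_div_cancel₀ _ (hφ0 s).ne']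
  have hlip : ContractingWith (1 / 2) F := by
    refine ⟨by norm_num, LipschitzWith.of_dist_le_mul fun v w => ?_⟩
    rw [Subtype.dist_eq, Subtype.dist_eq]
    refine (BoundedContinuousFunction.dist_le (by positivity)).2 fun s => ?_
    have h := hC _ _ (hcont v) v.2 (hcont w) w.2 (dist v.1 w.1) dist_nonneg (fun s => by
      rw [← mul_sub, abs_mul, abs_of_pos (hφ0 s), mul_comm]
      gcongr
      exacts [(hφ0 s).le, BoundedContinuousFunction.dist_coe_le_dist (f := v.1) (g := w.1) s]) s
    rw [← hF, ← hF, ← mul_sub, abs_mul, abs_of_pos (hφ0 s), mul_comm] at h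
    rw [Real.dist_eq]
    have h' := le_of_mul_le_mul_right h (hφ0 s)
    push_cast
    linarith
  have : Nonempty K := ⟨⟨0, fun s => by simpa using hκ0 s⟩⟩
  let v := ContractingWith.fixedPoint F hlip
  have hv : F v = v := hlip.fixedPoint_isFixedPt
  refine ⟨_, hcont v, v.2, funext fun s => ?_⟩
  rw [← hF v s, hv]

/-- Two functions at finite weighted distance coincide if this distance can always be halved. -/
theorem eq_of_weighted_dist_halving {φ f g : ℝ → ℝ} {M : ℝ} (hM : 0 ≤ M)
    (h0 : ∀ s, |f s - g s| ≤ M * φ s)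
    (h : ∀ C, 0 ≤ C → (∀ s, |f s - g s| ≤ C * φ s) → ∀ s, |f s - g s| ≤ C / 2 * φ s) :
    f = g := by
  have hn (j : ℕ) : ∀ s, |f s - g s| ≤ M * (1 / 2) ^ j * φ s := by
    induction j with
    | zero => simpa using h0
    | succ j ih =>
      intro s
      refine (h _ (by positivity) ih s).trans_eq ?_
      ring
  funext s
  have hlim : Tendsto (fun j : ℕ => M * (1 / 2 : ℝ) ^ j * φ s) atTop (𝓝 (M * 0 * φ s)) :=
    ((tendsto_pow_atTop_nhds_zero_of_lt_one (by norm_num) (by norm_num)).const_mul M).mul_const _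
  have := ge_of_tendsto' hlim fun j => hn j s
  rw [mul_zero, zero_mul] at this
  exact sub_eq_zero.1 (abs_nonpos_iff.1 this)

theorem Real.exp_sub_one_le_mul_exp (y : ℝ) : exp y - 1 ≤ y * exp y := by
  have h := mul_le_mul_of_nonneg_right (one_sub_le_exp_neg y) (exp_pos y).le
  rw [← exp_add, neg_add_cancel, exp_zero] at h
  linarith

theorem Real.abs_exp_sub_exp_le {u v y : ℝ} (hu : u ≤ y) (hv : v ≤ y) :
    |exp u - exp v| ≤ exp y * |u - v| := by
  wlog huv : v ≤ u generalizing u v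
  · rw [abs_sub_comm, abs_sub_comm u]
    exact this hv hu (le_of_not_ge huv)
  rw [abs_of_nonneg (sub_nonneg.2 (exp_le_exp.2 huv)), abs_of_nonneg (sub_nonneg.2 huv)]
  have h := mul_le_mul_of_nonneg_left (exp_sub_one_le_mul_exp (u - v)) (exp_pos v).le
  have h1 : exp v * exp (u - v) = exp u := by rw [← exp_add]; ring_nf
  have h2 := mul_le_mul_of_nonneg_right (exp_le_exp.2 hu) (sub_nonneg.2 huv)
  nlinarith

end Auxiliary

/-- Coefficients of the nonlocal Riccati equation
`z' = γ - a z - m z² - b e^{-k s} exp (θ ∫_{-∞}^s z) z`, together with the constant `B` of the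
barrier `B e^{k s}`. -/
structure RiccatiData where
  (a m b k θ γ B : ℝ)
  m_pos : 0 < m
  b_pos : 0 < b
  k_pos : 0 < k
  θ_pos : 0 < θ
  γ_pos : 0 < γ
  b_mul_B : b * B = γ + a ^ 2 / (4 * m)

namespace RiccatiData

noncomputable section

variable (D : RiccatiData)

theorem B_pos : 0 < D.B := by
  have h : 0 < D.b * D.B := by
    rw [D.b_mul_B]
    have := D.γ_pos
    have := D.m_pos
    positivity
  exact pos_of_mul_pos_right h D.b_pos.le

/-- Growth rate of `exp (θ ∫ z)` along the barrier. -/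
def q : ℝ := D.θ * D.B / D.k

theorem q_pos : 0 < D.q := div_pos (mul_pos D.θ_pos D.B_pos) D.k_pos

/-- Size of the extra damping needed to make the integral operator positive. -/
def c : ℝ := |D.a| + D.m * D.B + D.b * D.q + D.b * D.q ^ 2

theorem c_pos : 0 < D.c := by
  have := D.m_pos
  have := D.b_pos
  have := D.B_pos
  have := D.q_pos
  unfold c
  positivity

/-- Growth rate of the weight. -/
def μ : ℝ := (8 * D.c + 16 * D.c ^ 2 / D.b) / D.k

/-- The extra damping added on both sides of the equation. -/
def excess (s : ℝ) : ℝ := D.c * (1 + exp (D.k * s) * exp (D.q * exp (D.k * s)))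

/-- The integrating factor of the damping `b e^{-k s} + excess`. -/
def factor (s : ℝ) : ℝ :=
  exp (-(D.b / D.k) * exp (-D.k * s) + D.c * s + D.c / (D.k * D.q) * exp (D.q * exp (D.k * s)))

/-- The weight of the supremum distance for which the integral operator is a contraction. -/
def weight (s : ℝ) : ℝ := exp (D.k * s + D.μ / D.q * exp (D.q * exp (D.k * s)))

/-- Right-hand side of the equation once the damping `b e^{-k s} + excess` is moved to the left. -/
def forcing (z : ℝ → ℝ) (s : ℝ) : ℝ :=
  D.γ + (D.excess s - D.a - D.m * z s
    - D.b * exp (-D.k * s) * (exp (D.θ * ∫ t in Iio s, z t) - 1)) * z s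

/-- The integral operator whose fixed points solve the equation. -/
def picard (z : ℝ → ℝ) (s : ℝ) : ℝ := (∫ t in Iio s, D.factor t * D.forcing z t) / D.factor s

/-- Continuous functions between `0` and the barrier. -/
def Admissible (z : ℝ → ℝ) : Prop :=
  Continuous z ∧ ∀ s, 0 ≤ z s ∧ z s ≤ D.B * exp (D.k * s)

theorem factor_pos (s : ℝ) : 0 < D.factor s := exp_pos _

theorem weight_pos (s : ℝ) : 0 < D.weight s := exp_pos _

theorem continuous_excess : Continuous D.excess := by unfold excess; fun_prop

theorem continuous_factor : Continuous D.factor := by unfold factor; fun_prop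

theorem continuous_weight : Continuous D.weight := by unfold weight; fun_prop

theorem exp_neg_mul_exp (s : ℝ) : exp (-D.k * s) * exp (D.k * s) = 1 := by
  rw [← exp_add]; simp

theorem hasDerivAt_exp_mul (s : ℝ) :
    HasDerivAt (fun s => exp (D.k * s)) (D.k * exp (D.k * s)) s := by
  simpa [mul_comm] using ((hasDerivAt_id s).const_mul D.k).exp

theorem hasDerivAt_exp_exp (s : ℝ) :
    HasDerivAt (fun s => exp (D.q * exp (D.k * s)))
      (D.q * D.k * exp (D.k * s) * exp (D.q * exp (D.k * s))) s := by
  convert! ((D.hasDerivAt_exp_mul s).const_mul D.q).exp using 1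
  ring

theorem hasDerivAt_factor (s : ℝ) :
    HasDerivAt D.factor (D.factor s * (D.b * exp (-D.k * s) + D.excess s)) s := by
  have h1 : HasDerivAt (fun s => exp (-D.k * s)) (-D.k * exp (-D.k * s)) s := by
    simpa [mul_comm] using ((hasDerivAt_id s).const_mul (-D.k)).exp
  have hk := D.k_pos.ne'
  have hq := D.q_pos.ne'
  convert! (((h1.const_mul (-(D.b / D.k))).add ((hasDerivAt_id s).const_mul D.c)).add
    ((D.hasDerivAt_exp_exp s).const_mul (D.c / (D.k * D.q)))).exp using 1
  simp only [factor, excess, Pi.add_apply, id]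
  field_simp
  ring

theorem hasDerivAt_weight (s : ℝ) :
    HasDerivAt D.weight
      (D.weight s * (D.k + D.k * D.μ * exp (D.k * s) * exp (D.q * exp (D.k * s)))) s := by
  have hq := D.q_pos.ne'
  convert! (((hasDerivAt_id s).const_mul D.k).add
    ((D.hasDerivAt_exp_exp s).const_mul (D.μ / D.q))).exp using 1
  simp only [weight, Pi.add_apply, id]
  field_simp

theorem μ_pos : 0 < D.μ := by
  have := D.c_pos
  have := D.b_pos
  have := D.k_pos
  unfold μ
  positivity

theorem exp_le_weight (s : ℝ) : exp (D.k * s) ≤ D.weight s := by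
  have := D.μ_pos
  have := D.q_pos
  refine exp_le_exp.2 (le_add_of_nonneg_right ?_)
  positivity

theorem barrier_le (s : ℝ) : D.B * exp (D.k * s) ≤ D.B * D.weight s :=
  mul_le_mul_of_nonneg_left (D.exp_le_weight s) D.B_pos.le

/-- The weight grows fast enough to absorb the extra damping. -/
theorem excess_le (s : ℝ) :
    8 * D.excess s ≤ D.b * exp (-D.k * s)
      + D.k * D.μ * exp (D.k * s) * exp (D.q * exp (D.k * s)) := by
  have hxy := D.exp_neg_mul_exp s
  have hk := D.k_pos.ne'
  have hb := D.b_pos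
  have hμ : D.k * D.μ = 8 * D.c + 16 * D.c ^ 2 / D.b := by
    unfold μ
    field_simp
  rw [hμ]
  unfold excess
  have hx := exp_pos (D.k * s)
  have hy := exp_pos (-D.k * s)
  have he : 1 ≤ exp (D.q * exp (D.k * s)) := one_le_exp (mul_pos D.q_pos hx).le
  set x := exp (D.k * s)
  set y := exp (-D.k * s)
  set e := exp (D.q * x)
  have h1 : 8 * D.c ≤ D.b * y + 16 * D.c ^ 2 / D.b * x := by
    have h2 : 0 ≤ x / D.b * (D.b * y - 4 * D.c) ^ 2 := by positivity
    have h3 : x / D.b * (D.b * y - 4 * D.c) ^ 2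
        = D.b * y * (y * x) - 8 * D.c * (y * x) + 16 * D.c ^ 2 / D.b * x := by
      field_simp
      ring
    rw [h3, hxy] at h2
    linarith
  have h4 : 16 * D.c ^ 2 / D.b * x ≤ 16 * D.c ^ 2 / D.b * x * e :=
    le_mul_of_one_le_right (by positivity) he
  nlinarith

variable {D} {z z₁ z₂ : ℝ → ℝ}

theorem hasDerivAt_barrier_div (D : RiccatiData) (s : ℝ) :
    HasDerivAt (fun s => D.B / D.k * exp (D.k * s)) (D.B * exp (D.k * s)) s := by
  have hk := D.k_pos.ne'
  convert! (D.hasDerivAt_exp_mul s).const_mul (D.B / D.k) using 1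
  field_simp

theorem Admissible.integrableOn_and_abs_le (hz : D.Admissible z) (s : ℝ) :
    IntegrableOn z (Iic s) ∧ |∫ t in Iio s, z t| ≤ D.B / D.k * exp (D.k * s) :=
  integrableOn_Iic_and_abs_integral_le hz.1 D.hasDerivAt_barrier_div
    (fun t => by have := D.B_pos; have := D.k_pos; positivity)
    (fun t => by rw [abs_of_nonneg (hz.2 t).1]; exact (hz.2 t).2) s

theorem Admissible.integral_nonneg (hz : D.Admissible z) (s : ℝ) : 0 ≤ ∫ t in Iio s, z t :=
  MeasureTheory.integral_nonneg fun t => (hz.2 t).1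

theorem Admissible.θ_mul_integral_le (hz : D.Admissible z) (s : ℝ) :
    D.θ * ∫ t in Iio s, z t ≤ D.q * exp (D.k * s) := by
  refine (mul_le_mul_of_nonneg_left ((le_abs_self _).trans (hz.integrableOn_and_abs_le s).2)
    D.θ_pos.le).trans_eq ?_
  unfold q
  ring

theorem Admissible.hasDerivAt_integral (hz : D.Admissible z) (s : ℝ) :
    HasDerivAt (fun s => ∫ t in Iio s, z t) (z s) s :=
  hasDerivAt_integral_Iio hz.1 (fun s => (hz.integrableOn_and_abs_le s).1) s

theorem Admissible.continuous_forcing (hz : D.Admissible z) : Continuous (D.forcing z) := by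
  have hW : Continuous fun s => ∫ t in Iio s, z t :=
    continuous_iff_continuousAt.2 fun s => (hz.hasDerivAt_integral s).continuousAt
  have := D.continuous_excess
  have := hz.1
  unfold forcing
  fun_prop

theorem Admissible.damping_nonneg (hz : D.Admissible z) (s : ℝ) :
    0 ≤ D.b * exp (-D.k * s) * (exp (D.θ * ∫ t in Iio s, z t) - 1) :=
  mul_nonneg (mul_pos D.b_pos (exp_pos _)).le
    (sub_nonneg.2 (one_le_exp (mul_nonneg D.θ_pos.le (hz.integral_nonneg s))))

theorem le_excess (D : RiccatiData) (s : ℝ) :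
    |D.a| + D.m * (D.B * exp (D.k * s)) + D.b * D.q * exp (D.q * exp (D.k * s)) ≤ D.excess s := by
  have hx := exp_pos (D.k * s)
  have he : 1 ≤ exp (D.q * exp (D.k * s)) := one_le_exp (mul_pos D.q_pos hx).le
  have h1 := exp_sub_one_le_mul_exp (D.q * exp (D.k * s))
  have hq := D.q_pos
  have hb := D.b_pos
  have hB := D.B_pos
  have hm := D.m_pos
  unfold excess c
  set x := exp (D.k * s)
  set e := exp (D.q * x)
  have h2 : D.b * D.q * e ≤ D.b * D.q * (1 + D.q * x * e) := by gcongr; linarith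
  have h3 : D.m * (D.B * x) ≤ D.m * (D.B * x) * e := le_mul_of_one_le_right (by positivity) he
  have h4 : 0 ≤ |D.a| * (x * e) := by positivity
  have h5 : 0 ≤ D.m * D.B := by positivity
  have h6 : 0 ≤ D.b * D.q * (x * e) := by positivity
  have h7 : 0 ≤ D.b * D.q ^ 2 := by positivity
  nlinarith

theorem Admissible.damping_le (hz : D.Admissible z) (s : ℝ) :
    D.b * exp (-D.k * s) * (exp (D.θ * ∫ t in Iio s, z t) - 1)
      ≤ D.b * D.q * exp (D.q * exp (D.k * s)) := by
  have hxy := D.exp_neg_mul_exp s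
  have hb := D.b_pos
  have h1 := exp_sub_one_le_mul_exp (D.q * exp (D.k * s))
  have h2 := exp_le_exp.2 (hz.θ_mul_integral_le s)
  calc D.b * exp (-D.k * s) * (exp (D.θ * ∫ t in Iio s, z t) - 1)
      ≤ D.b * exp (-D.k * s) * (D.q * exp (D.k * s) * exp (D.q * exp (D.k * s))) := by
        gcongr
        linarith
    _ = D.b * D.q * exp (D.q * exp (D.k * s)) * (exp (-D.k * s) * exp (D.k * s)) := by ring
    _ = _ := by rw [hxy, mul_one]

theorem Admissible.forcing_ge (hz : D.Admissible z) (s : ℝ) : D.γ ≤ D.forcing z s := by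
  refine le_add_of_nonneg_right (mul_nonneg ?_ (hz.2 s).1)
  have := D.le_excess s
  have := hz.damping_le s
  have := mul_le_mul_of_nonneg_left (hz.2 s).2 D.m_pos.le
  linarith [le_abs_self D.a]

theorem Admissible.forcing_le (hz : D.Admissible z) (s : ℝ) :
    D.forcing z s ≤ (D.b * exp (-D.k * s) + D.excess s) * (D.B * exp (D.k * s)) := by
  have hxy := D.exp_neg_mul_exp s
  have hm := D.m_pos
  have h1 := mul_nonneg (hz.damping_nonneg s) (hz.2 s).1
  have hℓ : 0 ≤ D.excess s := by
    have := D.c_pos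
    unfold excess
    positivity
  have h2 := mul_le_mul_of_nonneg_left (hz.2 s).2 hℓ
  have h3 : D.γ - D.a * z s - D.m * z s ^ 2 ≤ D.b * D.B := by
    rw [D.b_mul_B]
    have : 0 ≤ D.m * (z s + D.a / (2 * D.m)) ^ 2 := by positivity
    have h4 : D.m * (z s + D.a / (2 * D.m)) ^ 2
        = D.m * z s ^ 2 + D.a * z s + D.a ^ 2 / (4 * D.m) := by
      field_simp
      ring
    linarith
  have h5 : D.b * exp (-D.k * s) * (D.B * exp (D.k * s)) = D.b * D.B := by
    linear_combination D.b * D.B * hxy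
  unfold forcing
  nlinarith

theorem hasDerivAt_factor_mul_barrier (D : RiccatiData) (s : ℝ) :
    HasDerivAt (fun s => D.factor s * (D.B * exp (D.k * s)))
      (D.factor s * ((D.b * exp (-D.k * s) + D.excess s) * (D.B * exp (D.k * s))
        + D.k * (D.B * exp (D.k * s)))) s := by
  convert! (D.hasDerivAt_factor s).mul ((D.hasDerivAt_exp_mul s).const_mul D.B) using 1
  ring

theorem Admissible.continuous_factor_mul_forcing (hz : D.Admissible z) :
    Continuous fun t => D.factor t * D.forcing z t :=
  D.continuous_factor.mul hz.continuous_forcing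

theorem Admissible.factor_mul_forcing_pos (hz : D.Admissible z) (t : ℝ) :
    0 < D.factor t * D.forcing z t :=
  mul_pos (D.factor_pos t) (D.γ_pos.trans_le (hz.forcing_ge t))

theorem Admissible.integrableOn_forcing_and_abs_le (hz : D.Admissible z) (s : ℝ) :
    IntegrableOn (fun t => D.factor t * D.forcing z t) (Iic s) ∧
      |∫ t in Iio s, D.factor t * D.forcing z t| ≤ D.factor s * (D.B * exp (D.k * s)) := by
  refine integrableOn_Iic_and_abs_integral_le hz.continuous_factor_mul_forcing
    D.hasDerivAt_factor_mul_barrier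
    (fun t => mul_nonneg (D.factor_pos t).le (mul_pos D.B_pos (exp_pos _)).le) (fun t => ?_) s
  rw [abs_of_pos (hz.factor_mul_forcing_pos t)]
  refine mul_le_mul_of_nonneg_left ((hz.forcing_le t).trans (le_add_of_nonneg_right ?_))
    (D.factor_pos t).le
  have := D.k_pos
  have := D.B_pos
  positivity

theorem Admissible.hasDerivAt_integral_forcing (hz : D.Admissible z) (s : ℝ) :
    HasDerivAt (fun s => ∫ t in Iio s, D.factor t * D.forcing z t)
      (D.factor s * D.forcing z s) s :=
  hasDerivAt_integral_Iio hz.continuous_factor_mul_forcing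
    (fun s => (hz.integrableOn_forcing_and_abs_le s).1) s

theorem Admissible.hasDerivAt_picard (hz : D.Admissible z) (s : ℝ) :
    HasDerivAt (D.picard z)
      (D.forcing z s - (D.b * exp (-D.k * s) + D.excess s) * D.picard z s) s := by
  have hE := (D.factor_pos s).ne'
  convert! (hz.hasDerivAt_integral_forcing s).div (D.hasDerivAt_factor s) hE using 1
  unfold picard
  field_simp

theorem Admissible.picard_pos (hz : D.Admissible z) (s : ℝ) : 0 < D.picard z s := by
  refine div_pos ?_ (D.factor_pos s)
  have hmono : StrictMono fun s => ∫ t in Iio s, D.factor t * D.forcing z t :=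
    strictMono_of_hasDerivAt_pos hz.hasDerivAt_integral_forcing hz.factor_mul_forcing_pos
  refine lt_of_le_of_lt ?_ (hmono (sub_one_lt s))
  exact MeasureTheory.integral_nonneg fun t => (hz.factor_mul_forcing_pos t).le

theorem Admissible.admissible_picard (hz : D.Admissible z) : D.Admissible (D.picard z) := by
  refine ⟨continuous_iff_continuousAt.2 fun s => (hz.hasDerivAt_picard s).continuousAt,
    fun s => ⟨(hz.picard_pos s).le, ?_⟩⟩
  rw [picard, div_le_iff₀ (D.factor_pos s), mul_comm]
  exact (le_abs_self _).trans (hz.integrableOn_forcing_and_abs_le s).2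

theorem Admissible.abs_integral_sub_le (h₁ : D.Admissible z₁) (h₂ : D.Admissible z₂) {C : ℝ}
    (hC : 0 ≤ C) (h : ∀ s, |z₁ s - z₂ s| ≤ C * D.weight s) (s : ℝ) :
    |(∫ t in Iio s, z₁ t) - ∫ t in Iio s, z₂ t| ≤ C / D.k * D.weight s := by
  have hk := D.k_pos
  have hμ := D.μ_pos
  rw [← integral_sub ((h₁.integrableOn_and_abs_le s).1.mono_set Iio_subset_Iic_self)
    ((h₂.integrableOn_and_abs_le s).1.mono_set Iio_subset_Iic_self)]
  refine (integrableOn_Iic_and_abs_integral_le (h₁.1.sub h₂.1)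
    (fun t => (D.hasDerivAt_weight t).const_mul (C / D.k))
    (fun t => mul_nonneg (by positivity) (D.weight_pos t).le)
    (fun t => (h t).trans ?_) s).2
  have hw := D.weight_pos t
  have : C / D.k * (D.weight t
      * (D.k + D.k * D.μ * exp (D.k * t) * exp (D.q * exp (D.k * t))))
      = C * D.weight t * (1 + D.μ * exp (D.k * t) * exp (D.q * exp (D.k * t))) := by
    field_simp
  rw [this]
  refine le_mul_of_one_le_right (by positivity) (le_add_of_nonneg_right (by positivity))

theorem Admissible.abs_forcing_sub_le (h₁ : D.Admissible z₁) (h₂ : D.Admissible z₂) {C : ℝ}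
    (hC : 0 ≤ C) (h : ∀ s, |z₁ s - z₂ s| ≤ C * D.weight s) (s : ℝ) :
    |D.forcing z₁ s - D.forcing z₂ s| ≤ 4 * D.excess s * (C * D.weight s) := by
  have hxy := D.exp_neg_mul_exp s
  have hk := D.k_pos
  have hb := D.b_pos
  have hθ := D.θ_pos
  have hB := D.B_pos
  have hW := h₁.abs_integral_sub_le h₂ hC h s
  have hexp := abs_exp_sub_exp_le (h₁.θ_mul_integral_le s) (h₂.θ_mul_integral_le s)
  have hd₁ := h₁.damping_le s
  have hd₁' := h₁.damping_nonneg s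
  have hℓ := D.le_excess s
  have hz₁ := mul_le_mul_of_nonneg_left (h₁.2 s).2 D.m_pos.le
  have hz₂ := mul_le_mul_of_nonneg_left (h₂.2 s).2 D.m_pos.le
  have hz₁' := mul_nonneg D.m_pos.le (h₁.2 s).1
  have hz₂' := mul_nonneg D.m_pos.le (h₂.2 s).1
  have hw := mul_nonneg hC (D.weight_pos s).le
  have hbq : 0 ≤ D.b * D.q * exp (D.q * exp (D.k * s)) := by
    have := D.q_pos
    positivity
  have hnn : 0 ≤ D.m * (D.B * exp (D.k * s)) := hz₁'.trans hz₁
  rw [← mul_sub, abs_mul, abs_of_pos hθ] at hexp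
  have hsplit : D.forcing z₁ s - D.forcing z₂ s =
      (D.excess s - D.a - D.m * z₁ s - D.m * z₂ s
        - D.b * exp (-D.k * s) * (exp (D.θ * ∫ t in Iio s, z₁ t) - 1)) * (z₁ s - z₂ s)
      - D.b * exp (-D.k * s) * z₂ s *
        (exp (D.θ * ∫ t in Iio s, z₁ t) - exp (D.θ * ∫ t in Iio s, z₂ t)) := by
    unfold forcing
    ring
  rw [hsplit]
  have hA : |(D.excess s - D.a - D.m * z₁ s - D.m * z₂ s
      - D.b * exp (-D.k * s) * (exp (D.θ * ∫ t in Iio s, z₁ t) - 1)) * (z₁ s - z₂ s)|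
      ≤ 3 * D.excess s * (C * D.weight s) := by
    rw [abs_mul]
    refine mul_le_mul ?_ (h s) (abs_nonneg _) ?_
    · rw [abs_le]
      constructor <;> linarith [le_abs_self D.a, neg_abs_le D.a, abs_nonneg D.a]
    · linarith [abs_nonneg D.a]
  have hAB : |D.b * exp (-D.k * s) * z₂ s *
      (exp (D.θ * ∫ t in Iio s, z₁ t) - exp (D.θ * ∫ t in Iio s, z₂ t))|
      ≤ D.excess s * (C * D.weight s) := by
    have hcoef : D.b * exp (-D.k * s) * z₂ s ≤ D.b * D.B := by
      calc D.b * exp (-D.k * s) * z₂ s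
          ≤ D.b * exp (-D.k * s) * (D.B * exp (D.k * s)) := by
            gcongr
            exact (h₂.2 s).2
        _ = D.b * D.B * (exp (-D.k * s) * exp (D.k * s)) := by ring
        _ = D.b * D.B := by rw [hxy, mul_one]
    have hcoef' : 0 ≤ D.b * exp (-D.k * s) * z₂ s :=
      mul_nonneg (by positivity) (h₂.2 s).1
    rw [abs_mul, abs_of_nonneg hcoef']
    calc _ ≤ D.b * D.B * (exp (D.q * exp (D.k * s)) * (D.θ * (C / D.k * D.weight s))) := by
          refine mul_le_mul hcoef (hexp.trans ?_) (abs_nonneg _) (by positivity)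
          gcongr
      _ = D.b * D.q * exp (D.q * exp (D.k * s)) * (C * D.weight s) := by
          unfold q
          ring
      _ ≤ _ := mul_le_mul_of_nonneg_right (by linarith [abs_nonneg D.a]) hw
  refine (abs_sub _ _).trans ?_
  linarith

theorem Admissible.abs_picard_sub_le (h₁ : D.Admissible z₁) (h₂ : D.Admissible z₂) {C : ℝ}
    (hC : 0 ≤ C) (h : ∀ s, |z₁ s - z₂ s| ≤ C * D.weight s) (s : ℝ) :
    |D.picard z₁ s - D.picard z₂ s| ≤ C / 2 * D.weight s := by
  have hE := D.factor_pos s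
  unfold picard
  rw [← sub_div, ← integral_sub
    ((h₁.integrableOn_forcing_and_abs_le s).1.mono_set Iio_subset_Iic_self)
    ((h₂.integrableOn_forcing_and_abs_le s).1.mono_set Iio_subset_Iic_self),
    abs_div, abs_of_pos hE, div_le_iff₀ hE]
  refine (integrableOn_Iic_and_abs_integral_le
    (h₁.continuous_factor_mul_forcing.sub h₂.continuous_factor_mul_forcing)
    (fun t => ((D.hasDerivAt_weight t).const_mul (C / 2)).mul (D.hasDerivAt_factor t))
    (fun t => mul_nonneg (mul_nonneg (by positivity) (D.weight_pos t).le) (D.factor_pos t).le)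
    (fun t => ?_) s).2
  have hEt := D.factor_pos t
  have hwt := D.weight_pos t
  have hℓ := D.excess_le t
  have hc := D.c_pos
  have hℓ0 : 0 ≤ D.excess t := by unfold excess; positivity
  have hF := h₁.abs_forcing_sub_le h₂ hC h t
  rw [Pi.sub_apply, ← mul_sub, abs_mul, abs_of_pos hEt]
  calc _ ≤ D.factor t * (4 * D.excess t * (C * D.weight t)) := by gcongr
    _ = C / 2 * D.weight t * D.factor t * (8 * D.excess t) := by ring
    _ ≤ C / 2 * D.weight t * D.factor t * (D.k + D.k * D.μ * exp (D.k * t)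
          * exp (D.q * exp (D.k * t)) + (D.b * exp (-D.k * t) + D.excess t)) := by
        gcongr
        linarith [D.k_pos]
    _ = _ := by ring

theorem tendsto_factor_mul_barrier (D : RiccatiData) :
    Tendsto (fun s => D.factor s * (D.B * exp (D.k * s))) atBot (𝓝 0) := by
  have hk := D.k_pos
  have hb := D.b_pos
  have hc := D.c_pos
  have hq := D.q_pos
  have hB := D.B_pos
  have hx : Tendsto (fun s => exp (D.k * s)) atBot (𝓝 0) :=
    tendsto_exp_atBot.comp (tendsto_id.const_mul_atBot hk)
  have hlim := (hx.const_mul D.B).const_mul (exp (D.c / (D.k * D.q) * exp D.q))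
  rw [mul_zero, mul_zero] at hlim
  refine squeeze_zero' (Eventually.of_forall fun s => ?_) ?_ hlim
  · have := D.factor_pos s
    positivity
  · filter_upwards [eventually_le_atBot 0] with s hs
    gcongr
    refine exp_le_exp.2 ?_
    have h1 : exp (D.k * s) ≤ 1 := exp_le_one_iff.2 (by nlinarith)
    have h2 : D.c / (D.k * D.q) * exp (D.q * exp (D.k * s)) ≤ D.c / (D.k * D.q) * exp D.q := by
      gcongr
      nlinarith
    have h3 : 0 ≤ D.b / D.k * exp (-D.k * s) := by positivity
    nlinarith

/-- `z` solves the nonlocal Riccati equation. -/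
def IsSolution (D : RiccatiData) (z : ℝ → ℝ) : Prop :=
  ∀ s, HasDerivAt z (D.γ - D.a * z s - D.m * z s ^ 2
    - D.b * exp (-D.k * s) * exp (D.θ * ∫ t in Iio s, z t) * z s) s

theorem Admissible.picard_eq (hz : D.Admissible z) (hsol : D.IsSolution z) :
    D.picard z = z := by
  funext s
  have hderiv : ∀ t, HasDerivAt (fun t => D.factor t * z t) (D.factor t * D.forcing z t) t := by
    intro t
    convert! (D.hasDerivAt_factor t).mul (hsol t) using 1
    unfold forcing
    ring
  have hlim : Tendsto (fun t => D.factor t * z t) atBot (𝓝 0) :=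
    squeeze_zero (fun t => mul_nonneg (D.factor_pos t).le (hz.2 t).1)
      (fun t => mul_le_mul_of_nonneg_left (hz.2 t).2 (D.factor_pos t).le)
      D.tendsto_factor_mul_barrier
  rw [picard, ← integral_Iic_eq_integral_Iio, integral_Iic_of_hasDerivAt_of_tendsto'
    (fun t _ => hderiv t) (hz.integrableOn_forcing_and_abs_le s).1 hlim, sub_zero,
    mul_div_cancel_left₀ _ (D.factor_pos s).ne']

theorem Admissible.eq_of_isSolution (h₁ : D.Admissible z₁) (h₂ : D.Admissible z₂)
    (hs₁ : D.IsSolution z₁) (hs₂ : D.IsSolution z₂) : z₁ = z₂ := by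
  refine eq_of_weighted_dist_halving D.B_pos.le (φ := D.weight) (fun s => ?_)
    (fun C hC h s => ?_)
  · refine le_trans ?_ (D.barrier_le s)
    rw [abs_le]
    constructor <;> linarith [h₁.2 s, h₂.2 s]
  · have := h₁.abs_picard_sub_le h₂ hC h s
    rwa [h₁.picard_eq hs₁, h₂.picard_eq hs₂] at this

theorem exists_isSolution (D : RiccatiData) :
    ∃ z, D.Admissible z ∧ (∀ s, 0 < z s) ∧ D.IsSolution z := by
  obtain ⟨z, hc, hb, hfix⟩ := exists_continuous_fixedPoint_of_weighted_contraction
    D.continuous_weight D.weight_pos (fun s => (mul_pos D.B_pos (exp_pos _)).le) D.barrier_le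
    D.picard (fun z hc hb => Admissible.admissible_picard ⟨hc, hb⟩)
    (fun z₁ z₂ hc₁ hb₁ hc₂ hb₂ C hC h =>
      Admissible.abs_picard_sub_le (D := D) ⟨hc₁, hb₁⟩ ⟨hc₂, hb₂⟩ hC h)
  have hz : D.Admissible z := ⟨hc, hb⟩
  refine ⟨z, hz, fun s => ?_, fun s => ?_⟩
  · have := hz.picard_pos s
    rwa [hfix] at this
  · have := hz.hasDerivAt_picard s
    rw [hfix] at this
    convert! this using 1
    unfold forcing
    ring

end

end RiccatiData

theorem stmt6 (n : ℕ) (m ρ1 η β α C1 C2 C3 C4 : ℝ)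
    (hn : 3 ≤ n) (hm0 : 0 < m) (hm1 : m < ((n : ℝ) - 2) / (n : ℝ))
    (hρ1 : 0 < ρ1) (hη : 0 < η)
    (hβ : m * ρ1 / ((n : ℝ) - 2 - (n : ℝ) * m) < β)
    (hα : α = (2 * β + ρ1) / (1 - m))
    (hC1 : C1 = 1 / (2 * m) * ((n : ℝ) - 2 - 2 * m * α / β))
    (hC2 : C2 = α / β * ((n : ℝ) - 2 - m * α / β))
    (hC3 : C3 = C2 + m * C1 ^ 2)
    (hC4 : C4 = C3 / β) :
    ∃! z : ℝ → ℝ, ZODEReal n m ρ1 η β α C4 z := by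
  have hn0 : (3 : ℝ) ≤ n := by exact_mod_cast hn
  have hnm : 0 < (n : ℝ) - 2 - n * m := by
    rw [lt_div_iff₀ (by linarith)] at hm1
    linarith
  have hβ0 : 0 < β := lt_trans (by positivity) hβ
  have hm' : 0 < 1 - m := by nlinarith
  have hα0 : 0 < α := by rw [hα]; positivity
  have hγ : 0 < C2 := by
    rw [hC2]
    refine mul_pos (by positivity) ?_
    rw [sub_pos, div_lt_iff₀ hβ0, hα, ← mul_div_assoc, div_lt_iff₀ hm']
    rw [div_lt_iff₀ hnm] at hβ
    linarith
  have hηm : η ^ (1 - m) * η ^ (m - 1) = 1 := by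
    rw [← rpow_add hη]; simp
  let D : RiccatiData :=
    { a := (n : ℝ) - 2 - 2 * m * α / β, m := m, b := β * η ^ (1 - m), k := ρ1 / β, θ := 1 - m
      γ := C2, B := C4 * η ^ (m - 1)
      m_pos := hm0, b_pos := by positivity, k_pos := by positivity, θ_pos := hm', γ_pos := hγ
      b_mul_B := by
        calc β * η ^ (1 - m) * (C4 * η ^ (m - 1)) = β * C4 * (η ^ (1 - m) * η ^ (m - 1)) := by ring
          _ = C3 := by rw [hηm, hC4]; field_simp
          _ = _ := by rw [hC3, hC1]; field_simp; ring }
  have hpow (W : ℝ) : (η * exp W) ^ (1 - m) = η ^ (1 - m) * exp ((1 - m) * W) := by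
    rw [mul_rpow hη.le (exp_pos W).le, ← exp_mul, mul_comm W]
  have hbound (y s : ℝ) :
      y * exp (-(ρ1 / β) * s) ≤ C4 * η ^ (m - 1) ↔ y ≤ C4 * η ^ (m - 1) * exp (ρ1 / β * s) := by
    rw [neg_mul, exp_neg, ← div_eq_mul_inv, div_le_iff₀ (exp_pos _)]
  have hsolution : ∀ z, ZODEReal n m ρ1 η β α C4 z → D.Admissible z ∧ D.IsSolution z := by
    rintro z ⟨hz, -, hode, hbd⟩
    refine ⟨⟨hz.continuous, fun s => ⟨?_, (hbound _ _).1 (hbd s).2⟩⟩, fun s => ?_⟩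
    · exact (pos_of_mul_pos_left (hbd s).1 (exp_pos _).le).le
    · convert! (hz.differentiable one_ne_zero s).hasDerivAt using 1
      have := hode s
      rw [hpow, ← hC2] at this
      simp only [D]
      linear_combination -this
  obtain ⟨z, hz, hpos, hsol⟩ := D.exists_isSolution
  refine ⟨z, ⟨?_, fun s => ?_, fun s => ?_, fun s => ⟨mul_pos (hpos s) (exp_pos _), ?_⟩⟩,
    fun y hy => ?_⟩
  · rw [contDiff_one_iff_deriv]
    refine ⟨fun s => (hsol s).differentiableAt, ?_⟩
    have hW : Continuous fun s => ∫ t in Iio s, z t :=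
      continuous_iff_continuousAt.2 fun s => (hz.hasDerivAt_integral s).continuousAt
    have := hz.1
    rw [funext fun s => (hsol s).deriv]
    fun_prop
  · exact (hz.integrableOn_and_abs_le s).1.mono_set Iio_subset_Iic_self
  · rw [(hsol s).deriv, hpow, ← hC2]
    simp only [D]
    ring
  · exact (hbound _ _).2 (hz.2 s).2
  · obtain ⟨hy, hysol⟩ := hsolution y hy
    exact hy.eq_of_isSolution hz hysol hsol
end

section
/- Let f be a positive function on (0,∞) such that r ↦ f(r)^m/m is twice continuously differentiable on (0,∞), (f^m/m)''(r) + ((n-1)/r)·(f^m/m)'(r) + α·f(r) + β·r·f'(r) = 0 for all r > 0, lim_{r→0+} r^{α/β}·f(r) = η, and, with w(r) = r^{α/β}·f(r) and z(s) = e^s·w'(e^s)/w(e^s), 0 < z(s)·e^{-(ρ1/β)s} ≤ C4·η^{m-1} for all s ∈ ℝ. Then f'(r) < 0 for all r > 0. -/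
open Real Set Filter

/-- `z(s) = e^s w'(e^s) / w(e^s)` where `w(r) = r^{α/β} f(r)`. -/
noncomputable def Zfun (α β : ℝ) (f : ℝ → ℝ) (s : ℝ) : ℝ :=
  Real.exp s * deriv (fun r => r ^ (α / β) * f r) (Real.exp s) /
    (Real.exp s ^ (α / β) * f (Real.exp s))

/-- radially symmetric solution of `Δ(f^m/m) + α f + β x·∇f = 0` on `(0,∞)`
with `lim_{r→0+} r^{α/β} f(r) = η`. -/
def FDESol (n : ℕ) (m α β η : ℝ) (f : ℝ → ℝ) : Prop :=
  (∀ r ∈ Set.Ioi (0 : ℝ), 0 < f r) ∧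
  ContDiffOn ℝ 2 (fun r => f r ^ m / m) (Set.Ioi 0) ∧
  (∀ r ∈ Set.Ioi (0 : ℝ),
    deriv (deriv (fun r' => f r' ^ m / m)) r
      + (((n : ℝ) - 1) / r) * deriv (fun r' => f r' ^ m / m) r
      + α * f r + β * r * deriv f r = 0) ∧
  Filter.Tendsto (fun r => r ^ (α / β) * f r) (nhdsWithin 0 (Set.Ioi 0)) (nhds η)

/-- the bound `0 < z(s) e^{-(ρ1/β) s} ≤ C4 η^{m-1}` for all `s ∈ ℝ`. -/
def FDEZBound (m α β ρ1 η C4 : ℝ) (f : ℝ → ℝ) : Prop :=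
  ∀ s : ℝ, 0 < Zfun α β f s * Real.exp (-(ρ1 / β) * s) ∧
    Zfun α β f s * Real.exp (-(ρ1 / β) * s) ≤ C4 * η ^ (m - 1)

open Topology

/-- A positive function is differentiable wherever one of its nontrivial powers is. -/
lemma differentiableAt_of_rpow_div {m r : ℝ} {f : ℝ → ℝ} (hm : 0 < m) (hr : 0 < r)
    (hpos : ∀ r ∈ Ioi (0 : ℝ), 0 < f r)
    (hg : DifferentiableAt ℝ (fun r => f r ^ m / m) r) : DifferentiableAt ℝ f r := by
  have hd : DifferentiableAt ℝ (fun r => (m * (f r ^ m / m)) ^ (1 / m)) r := by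
    refine (hg.const_mul m).rpow_const (Or.inl ?_)
    have := rpow_pos_of_pos (hpos r hr) m
    positivity
  refine hd.congr_of_eventuallyEq ?_
  filter_upwards [Ioi_mem_nhds hr] with x hx
  rw [mul_div_cancel₀ _ hm.ne', ← rpow_mul (hpos x hx).le, mul_one_div_cancel hm.ne', rpow_one]

lemma deriv_rpow_div {m r : ℝ} {f : ℝ → ℝ} (hm : 0 < m) (hf : DifferentiableAt ℝ f r)
    (hpos : 0 < f r) : deriv (fun r => f r ^ m / m) r = f r ^ (m - 1) * deriv f r := by
  rw [((hf.hasDerivAt.rpow_const (p := m) (Or.inl hpos.ne')).div_const m).deriv]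
  field_simp

lemma deriv_rpow_div_neg_iff {m r : ℝ} {f : ℝ → ℝ} (hm : 0 < m) (hf : DifferentiableAt ℝ f r)
    (hpos : 0 < f r) : deriv (fun r => f r ^ m / m) r < 0 ↔ deriv f r < 0 := by
  rw [deriv_rpow_div hm hf hpos]
  simp [mul_neg_iff, rpow_pos_of_pos hpos, (rpow_pos_of_pos hpos (m - 1)).not_gt]

/-- The logarithmic derivative of `r ^ (α / β) * f r`. -/
lemma Zfun_eq {α β s : ℝ} {f : ℝ → ℝ} (hf : DifferentiableAt ℝ f (exp s))
    (hpos : 0 < f (exp s)) :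
    Zfun α β f s = α / β + exp s * deriv f (exp s) / f (exp s) := by
  have hs := exp_pos s
  have hw := (hasDerivAt_rpow_const (p := α / β) (Or.inl hs.ne')).mul hf.hasDerivAt
  have hp := rpow_pos_of_pos hs (α / β)
  unfold Zfun
  rw [show (fun r => r ^ (α / β) * f r) = (fun r => r ^ (α / β)) * f from rfl, hw.deriv,
    rpow_sub_one hs.ne', div_eq_iff (by positivity)]
  generalize exp s ^ (α / β) = p at *
  generalize α / β = c at *
  field_simp

/-- A function that is negative near `0` and strictly decreasing at each of its zeros
stays negative. -/
lemma neg_of_deriv_neg_at_zeros {h : ℝ → ℝ} (hd : ∀ r ∈ Ioi (0 : ℝ), DifferentiableAt ℝ h r)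
    (h0 : ∀ᶠ r in 𝓝[>] (0 : ℝ), h r < 0)
    (hz : ∀ r ∈ Ioi (0 : ℝ), h r = 0 → deriv h r < 0) :
    ∀ r ∈ Ioi (0 : ℝ), h r < 0 := by
  intro r₁ hr₁
  by_contra! hge
  obtain ⟨ε, hε, hεr⟩ : ∃ ε, h ε < 0 ∧ ε ∈ Ioo 0 r₁ :=
    (h0.and (Ioo_mem_nhdsGT hr₁)).exists
  have hcont : ContinuousOn h (Icc ε r₁) := fun x hx =>
    (hd x (hεr.1.trans_le hx.1)).continuousAt.continuousWithinAt
  have hcomp : IsCompact (Icc ε r₁ ∩ h ⁻¹' Ici 0) :=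
    isCompact_Icc.of_isClosed_subset (hcont.preimage_isClosed_of_isClosed isClosed_Icc isClosed_Ici)
      inter_subset_left
  obtain ⟨r₀, ⟨hr₀, hr₀'⟩, hleast⟩ := hcomp.exists_isLeast ⟨r₁, ⟨hεr.2.le, le_rfl⟩, hge⟩
  have hr₀' : 0 ≤ h r₀ := hr₀'
  have hlt : ε < r₀ := lt_of_le_of_ne hr₀.1 (by rintro rfl; linarith)
  have hpos : 0 < r₀ := hεr.1.trans hlt
  have hleft : ∀ᶠ x in 𝓝[<] r₀, h x < 0 := by
    filter_upwards [Ioo_mem_nhdsLT hlt] with x hx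
    by_contra! hx0
    exact absurd (hleast ⟨⟨hx.1.le, hx.2.le.trans hr₀.2⟩, hx0⟩) (not_le.2 hx.2)
  have hzero : h r₀ = 0 := le_antisymm
    (le_of_tendsto ((hd r₀ hpos).continuousAt.tendsto.mono_left nhdsWithin_le_nhds)
      (hleft.mono fun _ hx => hx.le)) hr₀'
  have hslope : Tendsto (slope h r₀) (𝓝[<] r₀) (𝓝 (deriv h r₀)) :=
    (hasDerivAt_iff_tendsto_slope.1 (hd r₀ hpos).hasDerivAt).mono_left
      (nhdsWithin_mono _ fun x hx => ne_of_lt hx)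
  refine absurd (hz r₀ hpos hzero) (not_lt.2 (ge_of_tendsto hslope ?_))
  filter_upwards [hleft, self_mem_nhdsWithin] with x hx hxr
  rw [slope_def_field, hzero, sub_zero]
  exact div_nonneg_of_nonpos hx.le (sub_nonpos.2 (le_of_lt hxr))

/-- The upper bound on `Zfun` forces `f` to decrease near the origin. -/
lemma FDEZBound.eventually_deriv_neg {m α β ρ1 η C4 : ℝ} {f : ℝ → ℝ}
    (hz : FDEZBound m α β ρ1 η C4 f) (hα : 0 < α) (hβ : 0 < β) (hρ1 : 0 < ρ1)
    (hf : ∀ r ∈ Ioi (0 : ℝ), DifferentiableAt ℝ f r) (hpos : ∀ r ∈ Ioi (0 : ℝ), 0 < f r) :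
    ∀ᶠ r in 𝓝[>] (0 : ℝ), deriv f r < 0 := by
  have hlim : Tendsto (fun s : ℝ => C4 * η ^ (m - 1) * exp (ρ1 / β * s)) atBot (𝓝 0) := by
    simpa using (tendsto_exp_atBot.comp
      (tendsto_id.const_mul_atBot (div_pos hρ1 hβ))).const_mul (C4 * η ^ (m - 1))
  have hsmall := tendsto_log_nhdsGT_zero.eventually (hlim.eventually (gt_mem_nhds (div_pos hα hβ)))
  filter_upwards [hsmall, self_mem_nhdsWithin] with r hr hr0
  have hr0 : 0 < r := hr0
  by_contra! hge
  have hfr := hpos r hr0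
  have hZ := (hz (log r)).2
  rw [Zfun_eq (by rw [exp_log hr0]; exact hf r hr0) (by rwa [exp_log hr0]), exp_log hr0,
    neg_mul, exp_neg, ← div_eq_mul_inv, div_le_iff₀ (exp_pos _)] at hZ
  have : 0 ≤ r * deriv f r / f r := by positivity
  linarith

theorem stmt8 (n : ℕ) (m ρ1 η β α C1 C2 C3 C4 : ℝ)
    (hn : 3 ≤ n) (hm0 : 0 < m) (hm1 : m < ((n : ℝ) - 2) / (n : ℝ))
    (hρ1 : 0 < ρ1) (hη : 0 < η)
    (hβ : m * ρ1 / ((n : ℝ) - 2 - (n : ℝ) * m) < β)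
    (hα : α = (2 * β + ρ1) / (1 - m))
    (hC1 : C1 = 1 / (2 * m) * ((n : ℝ) - 2 - 2 * m * α / β))
    (hC2 : C2 = α / β * ((n : ℝ) - 2 - m * α / β))
    (hC3 : C3 = C2 + m * C1 ^ 2)
    (hC4 : C4 = C3 / β)
    (f : ℝ → ℝ) (hf : FDESol n m α β η f) (hz : FDEZBound m α β ρ1 η C4 f) :
    ∀ r ∈ Set.Ioi (0 : ℝ), deriv f r < 0 := by
  obtain ⟨hpos, hg, hode, -⟩ := hf
  have hn' : (3 : ℝ) ≤ n := by exact_mod_cast hn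
  rw [lt_div_iff₀ (by linarith)] at hm1
  have hβ0 : 0 < β := lt_trans (div_pos (by positivity) (by linarith)) hβ
  have hm' : 0 < 1 - m := by nlinarith
  have hα0 : 0 < α := by rw [hα]; positivity
  have hdg : ∀ r ∈ Ioi (0 : ℝ), DifferentiableAt ℝ (fun r => f r ^ m / m) r := fun r hr =>
    (hg.contDiffAt (Ioi_mem_nhds hr)).differentiableAt two_ne_zero
  have hddg : ∀ r ∈ Ioi (0 : ℝ), DifferentiableAt ℝ (deriv fun r => f r ^ m / m) r := fun r hr =>
    ((hg.deriv_of_isOpen (m := 1) isOpen_Ioi (by norm_num)).contDiffAt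
      (Ioi_mem_nhds hr)).differentiableAt one_ne_zero
  have hdf : ∀ r ∈ Ioi (0 : ℝ), DifferentiableAt ℝ f r := fun r hr =>
    differentiableAt_of_rpow_div hm0 hr hpos (hdg r hr)
  have hneg := neg_of_deriv_neg_at_zeros hddg
    (by
      filter_upwards [hz.eventually_deriv_neg hα0 hβ0 hρ1 hdf hpos, self_mem_nhdsWithin]
        with r hr hr0
      exact (deriv_rpow_div_neg_iff hm0 (hdf r hr0) (hpos r hr0)).2 hr)
    (by
      intro r hr hr0
      have hf0 : deriv f r = 0 := by
        rw [deriv_rpow_div hm0 (hdf r hr) (hpos r hr)] at hr0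
        exact (mul_eq_zero.1 hr0).resolve_left (rpow_pos_of_pos (hpos r hr) _).ne'
      have := hode r hr
      rw [hr0, hf0] at this
      linarith [mul_pos hα0 (hpos r hr)])
  exact fun r hr => (deriv_rpow_div_neg_iff hm0 (hdf r hr) (hpos r hr)).1 (hneg r hr)
end
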